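/- If G is a finite simple graph that is not isomorphic to a star K_{1,m} for any m ≥ 0, then every automorphism of the generalized Mycielskian μ_t(G) fixes the root w, for every t ≥ 1. -/

import Mathlib

open SimpleGraph

/-- The generalized Mycielskian `μ_t(G)`: levels `0,…,t` of copies of `V(G)`
plus a root `none`. Level-0 vertices are the original vertices. -/
def genMyc {V : Type*} (G : SimpleGraph V) (t : ℕ) :
    SimpleGraph (Option (Fin (t + 1) × V)) :=
  SimpleGraph.fromRel fun a b =>
    match a, b with
    | some (s, i), some (s', j) =>
        ((s : ℕ) = 0 ∧ (s' : ℕ) = 0 ∧ G.Adj i j) ∨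
        ((s' : ℕ) = (s : ℕ) + 1 ∧ G.Adj i j)
    | some (s, _), none => (s : ℕ) = t
    | _, _ => False

/-- The (traditional) Mycielskian `μ(G)`. -/
def myc {V : Type*} (G : SimpleGraph V) : SimpleGraph (Option (Fin 2 × V)) :=
  genMyc G 1

/-- The star `K_{1,m}` with center `0` and `m` leaves. -/
def starG (m : ℕ) : SimpleGraph (Fin (m + 1)) :=
  SimpleGraph.fromRel fun a _ => a = 0

/-- A `d`-coloring is distinguishing if only the trivial automorphism preserves it. -/
def IsDistinguishing {V : Type*} (H : SimpleGraph V) (d : ℕ) (c : V → Fin d) : Prop :=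
  ∀ φ : H ≃g H, (∀ v, c (φ v) = c v) → ∀ v, φ v = v

/-- The distinguishing number of a graph. -/
noncomputable def distNum {V : Type*} (H : SimpleGraph V) : ℕ :=
  sInf {d | ∃ c : V → Fin d, IsDistinguishing H d c}

namespace MycAux

variable {V : Type*}

/-- The copy of `S` on level `a`. -/
def Lv {t : ℕ} (a : Fin (t + 1)) (S : Set V) : Set (Option (Fin (t + 1) × V)) :=
  (fun i => some (a, i)) '' S

lemma mem_Lv {t : ℕ} (a : Fin (t + 1)) (S : Set V) (r : Fin (t + 1)) (j : V) :
    some (r, j) ∈ Lv a S ↔ r = a ∧ j ∈ S := by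
  simp only [Lv, Set.mem_image, Option.some.injEq, Prod.mk.injEq]
  constructor
  · rintro ⟨x, hx, rfl, rfl⟩; exact ⟨rfl, hx⟩
  · rintro ⟨rfl, h⟩; exact ⟨j, h, rfl, rfl⟩

lemma none_mem_Lv {t : ℕ} (a : Fin (t + 1)) (S : Set V) :
    ¬ (none ∈ Lv a S) := by
  simp [Lv]

lemma ncard_Lv {t : ℕ} (a : Fin (t + 1)) (S : Set V) : (Lv a S).ncard = S.ncard := by
  apply Set.ncard_image_of_injective
  intro x y h
  simpa using h

lemma disj_Lv {t : ℕ} {a b : Fin (t + 1)} (h : a ≠ b) (S T : Set V) :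
    Disjoint (Lv a S) (Lv b T) := by
  rw [Set.disjoint_left]
  rintro (_ | ⟨r, j⟩) h1 h2
  · exact none_mem_Lv _ _ h1
  · rw [mem_Lv] at h1 h2
    exact h (h1.1.symm.trans h2.1)

lemma ncard_two [Fintype V] {t : ℕ} {a b : Fin (t + 1)} (h : a ≠ b) (S : Set V) :
    (Lv a S ∪ Lv b S).ncard = 2 * S.ncard := by
  rw [Set.ncard_union_eq (disj_Lv h S S) (Set.toFinite _) (Set.toFinite _), ncard_Lv, ncard_Lv]
  ring

lemma ncard_ins [Fintype V] {t : ℕ} (a : Fin (t + 1)) (S : Set V) :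
    (insert none (Lv a S)).ncard = S.ncard + 1 := by
  rw [Set.ncard_insert_of_notMem (none_mem_Lv _ _) (Set.toFinite _), ncard_Lv]

lemma adj_some (G : SimpleGraph V) (t : ℕ) (s r : Fin (t + 1)) (i j : V) :
    (genMyc G t).Adj (some (s, i)) (some (r, j)) ↔
      ((r : ℕ) = s + 1 ∨ (r : ℕ) = s - 1) ∧ G.Adj i j := by
  simp only [genMyc, SimpleGraph.fromRel_adj, G.adj_comm j i]
  constructor
  · rintro ⟨_, (h | h) | (h | h)⟩ <;> refine ⟨by omega, by tauto⟩
  · rintro ⟨h, hij⟩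
    have := hij.ne
    refine ⟨by simp [this], ?_⟩
    simp only [hij, and_true]
    omega

lemma adj_none (G : SimpleGraph V) (t : ℕ) (s : Fin (t + 1)) (i : V) :
    (genMyc G t).Adj (some (s, i)) none ↔ (s : ℕ) = t := by
  simp [genMyc]

lemma nbr_none (G : SimpleGraph V) (t : ℕ) (s : Fin (t + 1)) (hs : (s : ℕ) = t) :
    (genMyc G t).neighborSet none = Lv s Set.univ := by
  ext (_ | ⟨r, j⟩)
  · simp [none_mem_Lv]
  · rw [mem_Lv, SimpleGraph.mem_neighborSet, SimpleGraph.adj_comm, adj_none, Fin.ext_iff, hs]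
    simp

lemma nbr_low (G : SimpleGraph V) (t : ℕ) (s a b : Fin (t + 1)) (i : V)
    (ha : (a : ℕ) = s - 1) (hb : (b : ℕ) = s + 1) :
    (genMyc G t).neighborSet (some (s, i)) =
      Lv a (G.neighborSet i) ∪ Lv b (G.neighborSet i) := by
  ext (_ | ⟨r, j⟩)
  · have := b.2
    simp [none_mem_Lv, adj_none]
    omega
  · rw [Set.mem_union, mem_Lv, mem_Lv, SimpleGraph.mem_neighborSet, adj_some, Fin.ext_iff,
      Fin.ext_iff, ha, hb, SimpleGraph.mem_neighborSet]
    tauto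

lemma nbr_top (G : SimpleGraph V) (t : ℕ) (s a : Fin (t + 1)) (i : V)
    (ha : (a : ℕ) = s - 1) (hs : (s : ℕ) = t) :
    (genMyc G t).neighborSet (some (s, i)) = insert none (Lv a (G.neighborSet i)) := by
  ext (_ | ⟨r, j⟩)
  · simp [adj_none, hs]
  · have := r.2
    rw [Set.mem_insert_iff, mem_Lv, SimpleGraph.mem_neighborSet, adj_some, Fin.ext_iff,
      ha, SimpleGraph.mem_neighborSet]
    have : (r : ℕ) ≠ s + 1 := by omega
    simp [this]

lemma star_of [Fintype V] (G : SimpleGraph V) (i : V)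
    (h1 : (G.neighborSet i).ncard + 1 = Fintype.card V)
    (h2 : ∀ k, k ≠ i → (G.neighborSet k).ncard = 1) :
    ∃ m, Nonempty (G ≃g starG m) := by
  classical
  have hu : insert i (G.neighborSet i) = Set.univ := by
    apply Set.eq_of_subset_of_ncard_le (Set.subset_univ _) _ (Set.toFinite _)
    rw [Set.ncard_insert_of_notMem (by simp) (Set.toFinite _), Set.ncard_univ,
      Nat.card_eq_fintype_card, h1]
  have hi : ∀ k, k ≠ i → G.Adj i k := by
    intro k hk
    have : k ∈ insert i (G.neighborSet i) := by rw [hu]; trivial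
    simpa [hk] using this
  have hadj : ∀ a b, G.Adj a b ↔ a ≠ b ∧ (a = i ∨ b = i) := by
    intro a b
    constructor
    · intro h
      refine ⟨h.ne, ?_⟩
      by_cases ha : a = i
      · exact Or.inl ha
      · right
        obtain ⟨c, hc⟩ := Set.ncard_eq_one.1 (h2 a ha)
        have e1 : b ∈ G.neighborSet a := h
        have e2 : i ∈ G.neighborSet a := (hi a ha).symm
        rw [hc] at e1 e2
        exact e1.trans e2.symm
    · rintro ⟨hne, rfl | rfl⟩
      · exact hi b hne.symm
      · exact (hi a hne).symm
  refine ⟨(G.neighborSet i).ncard, ?_⟩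
  let e : V ≃ Fin ((G.neighborSet i).ncard + 1) := Fintype.equivFinOfCardEq h1.symm
  let e' := e.trans (Equiv.swap (e i) 0)
  have h0 : ∀ a, e' a = 0 ↔ a = i := by
    intro a
    have : e' i = 0 := by simp [e']
    rw [← this, e'.injective.eq_iff]
  refine ⟨⟨e', ?_⟩⟩
  intro a b
  rw [hadj, starG, SimpleGraph.fromRel_adj, h0, h0, e'.injective.ne_iff]

lemma Lv_inter {t : ℕ} (a : Fin (t + 1)) (S T : Set V) : Lv a S ∩ Lv a T = Lv a (S ∩ T) := by
  ext (_ | ⟨r, j⟩)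
  · simp [none_mem_Lv]
  · simp only [Set.mem_inter_iff, mem_Lv]; tauto

/-- common neighbours with the root are half of the neighbourhood -/
lemma half_root [Fintype V] (G : SimpleGraph V) (t : ℕ) (ht : 1 ≤ t)
    (y : Option (Fin (t + 1) × V)) (hy : y ≠ none)
    (hne : ((genMyc G t).neighborSet none ∩ (genMyc G t).neighborSet y).Nonempty) :
    2 * ((genMyc G t).neighborSet none ∩ (genMyc G t).neighborSet y).ncard =
      ((genMyc G t).neighborSet y).ncard := by
  obtain _ | ⟨r, k⟩ := y
  · exact absurd rfl hy
  have hr : (r : ℕ) + 1 = t := by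
    obtain ⟨z, hz1, hz2⟩ := hne
    obtain _ | ⟨q, l⟩ := z
    · simp at hz1
    · rw [SimpleGraph.mem_neighborSet, SimpleGraph.adj_comm, adj_none] at hz1
      rw [SimpleGraph.mem_neighborSet, adj_some] at hz2
      have := r.2
      omega
  let b : Fin (t + 1) := ⟨t, by omega⟩
  let a : Fin (t + 1) := ⟨r - 1, by omega⟩
  have hab : a ≠ b := by simp [a, b, Fin.ext_iff]; omega
  rw [nbr_none G t b rfl, nbr_low G t r a b k rfl hr.symm, ncard_two hab,
    Set.inter_union_distrib_left, (disj_Lv hab.symm _ _).inter_eq, Set.empty_union, Lv_inter,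
    ncard_Lv, Set.univ_inter]

end MycAux

open MycAux in
theorem stmt_9 {V : Type*} [Fintype V] (G : SimpleGraph V)
    (hG : ∀ m : ℕ, ¬ Nonempty (G ≃g starG m)) (t : ℕ) (ht : 1 ≤ t)
    (φ : genMyc G t ≃g genMyc G t) :
    φ none = none := by
  classical
  by_contra hw
  have himg : ∀ y, (genMyc G t).neighborSet (φ y) = φ '' (genMyc G t).neighborSet y := by
    intro y
    ext z
    obtain ⟨z, rfl⟩ := φ.surjective z
    rw [SimpleGraph.mem_neighborSet, φ.map_adj_iff]
    constructor
    · intro h; exact ⟨z, h, rfl⟩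
    · rintro ⟨z', h, e⟩
      rw [← φ.injective e]; exact h
  have hdeg : ∀ y, ((genMyc G t).neighborSet (φ y)).ncard = ((genMyc G t).neighborSet y).ncard := by
    intro y
    rw [himg, Set.ncard_image_of_injective _ φ.injective]
  have hhalf : ∀ y, y ≠ φ none →
      ((genMyc G t).neighborSet (φ none) ∩ (genMyc G t).neighborSet y).Nonempty →
      2 * ((genMyc G t).neighborSet (φ none) ∩ (genMyc G t).neighborSet y).ncard =
      ((genMyc G t).neighborSet y).ncard := by
    intro y hy hne
    obtain ⟨y, rfl⟩ := φ.surjective y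
    rw [hdeg]
    rw [himg, himg, ← Set.image_inter φ.injective] at hne ⊢
    rw [Set.ncard_image_of_injective _ φ.injective]
    exact half_root G t ht y (fun h => hy (by rw [h])) (Set.image_nonempty.1 hne)
  let T : Fin (t + 1) := ⟨t, by omega⟩
  have hcard : ((genMyc G t).neighborSet (φ none)).ncard = Fintype.card V := by
    rw [hdeg, nbr_none G t T rfl, ncard_Lv, Set.ncard_univ, Nat.card_eq_fintype_card]
  -- neighbours of the image have degree `d_j + 1`
  have hnb : ∀ j, ∃ z ∈ (genMyc G t).neighborSet (φ none),
      ((genMyc G t).neighborSet z).ncard = (G.neighborSet j).ncard + 1 := by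
    intro j
    refine ⟨φ (some (T, j)), ?_, ?_⟩
    · rw [SimpleGraph.mem_neighborSet, φ.map_adj_iff, SimpleGraph.adj_comm, adj_none]
    · rw [hdeg, nbr_top G t T ⟨t - 1, by omega⟩ j rfl rfl, ncard_ins]
  obtain ⟨x, hx⟩ : ∃ x, x = φ none := ⟨_, rfl⟩
  rw [← hx] at hw hhalf hcard hnb
  obtain _ | ⟨s, i⟩ := x
  · exact hw rfl
  let a : Fin (t + 1) := ⟨s - 1, by omega⟩
  by_cases hs : (s : ℕ) = t
  · -- top level
    rw [nbr_top G t s a i rfl hs, ncard_ins] at hcard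
    obtain ⟨m, hm⟩ := star_of G i hcard (by
      intro k hk
      have h := hhalf (some (s, k)) (by simpa using hk) ⟨none, by simp [adj_none, hs]⟩
      rw [nbr_top G t s a i rfl hs, nbr_top G t s a k rfl hs, ← Set.insert_inter_distrib, Lv_inter,
        ncard_ins, ncard_ins] at h
      have hu : insert i (G.neighborSet i) = Set.univ := by
        apply Set.eq_of_subset_of_ncard_le (Set.subset_univ _) _ (Set.toFinite _)
        rw [Set.ncard_insert_of_notMem (by simp) (Set.toFinite _), Set.ncard_univ,
          Nat.card_eq_fintype_card, hcard]
      have hi : ∀ k, k ≠ i → G.Adj i k := by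
        intro k hk
        have : k ∈ insert i (G.neighborSet i) := by rw [hu]; trivial
        simpa [hk] using this
      have hins : insert i (G.neighborSet i ∩ G.neighborSet k) = G.neighborSet k := by
        ext l
        simp only [Set.mem_insert_iff, Set.mem_inter_iff, SimpleGraph.mem_neighborSet]
        constructor
        · rintro (rfl | h)
          · exact (hi k hk).symm
          · exact h.2
        · intro h
          by_cases hl : l = i
          · exact Or.inl hl
          · exact Or.inr ⟨hi l hl, h⟩
      have := congrArg Set.ncard hins
      rw [Set.ncard_insert_of_notMem (by simp) (Set.toFinite _)] at this
      omega)
    exact hG m hm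
  · have hst : (s : ℕ) < t := by omega
    let b : Fin (t + 1) := ⟨s + 1, by omega⟩
    have hab : a ≠ b := by simp [a, b, Fin.ext_iff]
    have hN : ∀ k, (genMyc G t).neighborSet (some (s, k)) = _ :=
      fun k => nbr_low G t s a b k rfl rfl
    rw [hN, ncard_two hab] at hcard
    -- second neighbourhood of `i` is trivial
    have key : ∀ k, k ≠ i → ¬ (G.neighborSet i ∩ G.neighborSet k).Nonempty := by
      rintro k hk ⟨l, hl⟩
      have hc : 0 < (G.neighborSet i ∩ G.neighborSet k).ncard :=
        (Set.ncard_pos (Set.toFinite _)).2 ⟨l, hl⟩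
      have h1 := hhalf (some (s, k)) (by simpa using hk)
        ⟨some (a, l), by
          rw [hN, hN]
          exact ⟨Or.inl ((mem_Lv ..).2 ⟨rfl, hl.1⟩), Or.inl ((mem_Lv ..).2 ⟨rfl, hl.2⟩)⟩⟩
      have e1 : (Lv a (G.neighborSet i) ∪ Lv b (G.neighborSet i)) ∩
          (Lv a (G.neighborSet k) ∪ Lv b (G.neighborSet k)) =
          Lv a (G.neighborSet i ∩ G.neighborSet k) ∪ Lv b (G.neighborSet i ∩ G.neighborSet k) := by
        ext (_ | ⟨r, j⟩)
        · simp [none_mem_Lv]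
        · simp only [Set.mem_inter_iff, Set.mem_union, mem_Lv]
          constructor
          · rintro ⟨h | h, h' | h'⟩ <;> tauto
          · tauto
      rw [hN, hN, e1, ncard_two hab, ncard_two hab] at h1
      -- common neighbours when the second vertex lies on a level `c` sharing only level `a`
      have e2 : ∀ d : Fin (t + 1), d ≠ a → d ≠ b →
          (Lv a (G.neighborSet i) ∪ Lv b (G.neighborSet i)) ∩
          (Lv a (G.neighborSet k) ∪ Lv d (G.neighborSet k)) =
          Lv a (G.neighborSet i ∩ G.neighborSet k) := by
        intro d hda hdb
        ext (_ | ⟨r, j⟩)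
        · simp [none_mem_Lv]
        · simp only [Set.mem_inter_iff, Set.mem_union, mem_Lv]
          constructor
          · rintro ⟨⟨h, h2⟩ | ⟨h, h2⟩, ⟨h', h3⟩ | ⟨h', h3⟩⟩
            · exact ⟨h, h2, h3⟩
            · exact absurd (h'.symm.trans h) hda
            · exact ⟨h', h2, h3⟩
            · exact absurd (h'.symm.trans h) hdb
          · tauto
      by_cases hs0 : (s : ℕ) = 0
      · by_cases ht1 : t = 1
        · -- use level 1 = top
          have hNb := nbr_top G t b a k (by simp [a, b, hs0]) (by simp [b]; omega)
          have e3 : (Lv a (G.neighborSet i) ∪ Lv b (G.neighborSet i)) ∩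
              insert none (Lv a (G.neighborSet k)) =
              Lv a (G.neighborSet i ∩ G.neighborSet k) := by
            ext (_ | ⟨r, j⟩)
            · simp [none_mem_Lv]
            · simp only [Set.mem_inter_iff, Set.mem_union, mem_Lv, Set.mem_insert_iff]
              constructor
              · rintro ⟨⟨h, h2⟩ | ⟨h, h2⟩, h' | ⟨h', h3⟩⟩
                · cases h'
                · exact ⟨h, h2, h3⟩
                · cases h'
                · exact ⟨h', h2, h3⟩
              · tauto
          have h2 := hhalf (some (b, k)) (by simp [hk]) ⟨some (a, l), by
            rw [hN, hNb, e3]; exact (mem_Lv ..).2 ⟨rfl, hl⟩⟩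
          rw [hN, hNb, e3, ncard_Lv, ncard_ins] at h2
          omega
        · let d : Fin (t + 1) := ⟨s + 2, by omega⟩
          have hda : d ≠ a := by simp [a, d, Fin.ext_iff]; omega
          have hdb : d ≠ b := by simp [b, d, Fin.ext_iff]
          have hNb := nbr_low G t b a d k (by simp [a, b, hs0]) (by simp [b, d])
          have h2 := hhalf (some (b, k)) (by simp [hk]) ⟨some (a, l), by
            rw [hN, hNb, e2 d hda hdb]; exact (mem_Lv ..).2 ⟨rfl, hl⟩⟩
          rw [hN, hNb, e2 d hda hdb, ncard_Lv, ncard_two hda.symm] at h2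
          omega
      · by_cases hs1 : (s : ℕ) = 1
        · -- use level 0, whose neighbour levels are 0 and 1 = s
          have hda : s ≠ a := by simp [a, Fin.ext_iff]; omega
          have hdb : s ≠ b := by simp [b, Fin.ext_iff]
          have hNb : (genMyc G t).neighborSet (some (a, k)) = _ :=
            nbr_low G t a a s k (by simp [a, hs1]) (by simp [a, hs1])
          have h2 := hhalf (some (a, k)) (by simp [hk]) ⟨some (a, l), by
            rw [hN, hNb, e2 s hda hdb]; exact (mem_Lv ..).2 ⟨rfl, hl⟩⟩
          rw [hN, hNb, e2 s hda hdb, ncard_Lv, ncard_two hda.symm] at h2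
          omega
        · let c : Fin (t + 1) := ⟨s - 2, by omega⟩
          let d : Fin (t + 1) := ⟨s - 2 - 1, by omega⟩
          have hda : d ≠ a := by simp [a, d, Fin.ext_iff]; omega
          have hdb : d ≠ b := by simp [b, d, Fin.ext_iff]; omega
          have hNb : (genMyc G t).neighborSet (some (c, k)) = _ :=
            nbr_low G t c d a k rfl (by simp [a, c]; omega)
          rw [Set.union_comm] at hNb
          have h2 := hhalf (some (c, k)) (by simp [hk]) ⟨some (a, l), by
            rw [hN, hNb, e2 d hda hdb]; exact (mem_Lv ..).2 ⟨rfl, hl⟩⟩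
          rw [hN, hNb, e2 d hda hdb, ncard_Lv, ncard_two hda.symm] at h2
          omega
    have hleaf : ∀ j, G.Adj i j → (G.neighborSet j).ncard = 1 := by
      intro j hj
      rw [Set.ncard_eq_one]
      refine ⟨i, ?_⟩
      ext k
      simp only [SimpleGraph.mem_neighborSet, Set.mem_singleton_iff]
      constructor
      · intro h
        by_contra hk
        exact key k hk ⟨j, hj, h.symm⟩
      · rintro rfl; exact hj.symm
    have hone : ∀ j, (G.neighborSet j).ncard = 1 := by
      intro j
      obtain ⟨z, hz, hzd⟩ := hnb j
      suffices ((genMyc G t).neighborSet z).ncard = 2 by omega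
      obtain _ | ⟨r, k⟩ := z
      · rw [SimpleGraph.mem_neighborSet, adj_none] at hz
        omega
      · rw [SimpleGraph.mem_neighborSet, adj_some] at hz
        have hk := hleaf k hz.2
        have hr := r.2
        let a' : Fin (t + 1) := ⟨r - 1, by omega⟩
        by_cases hrt : (r : ℕ) = t
        · rw [nbr_top G t r a' k rfl hrt, ncard_ins, hk]
        · let b' : Fin (t + 1) := ⟨r + 1, by omega⟩
          rw [nbr_low G t r a' b' k rfl rfl, ncard_two, hk]
          simp [a', b', Fin.ext_iff]
    obtain ⟨m, hm⟩ := star_of G i (by have := hone i; omega) (fun k _ => hone k)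
    exact hG m hm
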